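/- A_n q-Pfaff–Saalschütz summation (first form): Let n be a positive integer, N_1, …, N_n nonnegative integers with |N| = N_1 + ⋯ + N_n, q a nonzero complex number that is not a root of unity, and a, b, c, x_1, …, x_n nonzero complex numbers, generic so that no denominator below vanishes. Then ∑_{k_1=0}^{N_1} ⋯ ∑_{k_n=0}^{N_n} ∏_{1≤i<j≤n} (x_i·q^{k_i} − x_j·q^{k_j})/(x_i − x_j) · ∏_{i,j=1}^n (q^{−N_j}·x_i/x_j; q)_{k_i}/(q·x_i/x_j; q)_{k_i} · ∏_{i=1}^n (a·x_i; q)_{k_i}/(c·x_i; q)_{k_i} · (b; q)_{|k|}/(a·b·q^{1−|N|}/c; q)_{|k|} · q^{|k|} = (c/a; q)_{|N|}/(c/(ab); q)_{|N|} · ∏_{i=1}^n (c·x_i/b; q)_{N_i}/(c·x_i; q)_{N_i}, where |k| = k_1 + ⋯ + k_n. -/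

import Mathlib

open Finset

/-- The q-shifted factorial `(a;q)_k`. -/
noncomputable def qPoch (q a : ℂ) (k : ℕ) : ℂ := ∏ i ∈ Finset.range k, (1 - a * q ^ i)

open Polynomial in
/-- The leading coefficient of a product of `#U` polynomials of degree at most one. -/
lemma degree_prod_linear_sub_lt {ι : Type*} (U : Finset ι) (u v v' : ι → ℂ) :
    (∏ i ∈ U, (C (u i) * X - C (v i)) - C (∏ i ∈ U, u i) * ∏ i ∈ U, (X - C (v' i))).degree
      < (#U : ℕ) := by
  have h1 : ∀ i, (C (u i) * X - C (v i)).natDegree ≤ 1 := fun i => by compute_degree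
  have h2 : (∏ i ∈ U, (C (u i) * X - C (v i))).natDegree ≤ #U := by
    refine (natDegree_prod_le _ _).trans ?_
    simpa using Finset.sum_le_card_nsmul U _ 1 fun i _ => h1 i
  have h3 : (∏ i ∈ U, (X - C (v' i))).natDegree = #U := by simp
  have h4 : (C (∏ i ∈ U, u i) * ∏ i ∈ U, (X - C (v' i))).natDegree ≤ #U :=
    (natDegree_C_mul_le _ _).trans h3.le
  refine (degree_lt_iff_coeff_zero _ _).2 fun m hm => ?_
  rcases hm.eq_or_lt with rfl | hm
  · have h5 := coeff_prod_of_natDegree_le U (fun i => C (u i) * X - C (v i)) 1 fun i _ => h1 i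
    have h6 : (∏ i ∈ U, (X - C (v' i))).coeff #U = 1 := by
      rw [← h3]; exact monic_prod_X_sub_C v' U
    rw [mul_one] at h5
    rw [coeff_sub, coeff_C_mul, h6, h5]
    simp [coeff_C]
  · rw [coeff_sub, coeff_eq_zero_of_natDegree_lt (h2.trans_lt hm),
      coeff_eq_zero_of_natDegree_lt (h4.trans_lt hm), sub_zero]

/-- The summand indexed by the subset `S` of `U` of a Macdonald-operator type sum. -/
noncomputable def subsetTerm {ι : Type*} [DecidableEq ι] (t a c : ℂ) (z : ι → ℂ)
    (U S : Finset ι) : ℂ :=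
  (∏ i ∈ S, ∏ j ∈ U \ S, (t * z i - z j) / (z i - z j)) *
    (∏ i ∈ S, (1 - a * z i)) * ∏ j ∈ U \ S, (1 - c * z j)

section SubsetSum

variable {ι : Type*} [DecidableEq ι] {t a c : ℂ} {z : ι → ℂ} {U S : Finset ι} {p : ι}

lemma subsetTerm_insert_insert (hp : p ∉ U) (hS : S ⊆ U) :
    subsetTerm t a c z (insert p U) (insert p S) = subsetTerm t a c z U S *
      ((1 - a * z p) * ∏ j ∈ U \ S, (t * z p - z j) / (z p - z j)) := by
  have hpS : p ∉ S := fun h => hp (hS h)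
  have h : insert p U \ insert p S = U \ S := by
    rw [Finset.insert_sdiff_insert, Finset.sdiff_insert_of_notMem hp]
  simp only [subsetTerm, h, Finset.prod_insert hpS]
  ring

lemma subsetTerm_insert (hp : p ∉ U) (hS : S ⊆ U) :
    subsetTerm t a c z (insert p U) S = subsetTerm t a c z U S *
      ((1 - c * z p) * ∏ i ∈ S, (t * z i - z p) / (z i - z p)) := by
  have hpS : p ∉ S := fun h => hp (hS h)
  have h : insert p U \ S = insert p (U \ S) := Finset.insert_sdiff_of_notMem _ hpS
  have hp' : p ∉ U \ S := fun h => hp (Finset.mem_sdiff.1 h).1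
  simp only [subsetTerm, h, Finset.prod_insert hp', Finset.prod_mul_distrib]
  ring

lemma sum_subsetTerm_insert (hp : p ∉ U) (w : ℕ → ℂ) :
    ∑ S ∈ (insert p U).powerset, w #S * subsetTerm t a c z (insert p U) S =
      ∑ S ∈ U.powerset, subsetTerm t a c z U S *
        (w #S * ((1 - c * z p) * ∏ i ∈ S, (t * z i - z p) / (z i - z p)) +
          w (#S + 1) * ((1 - a * z p) * ∏ j ∈ U \ S, (t * z p - z j) / (z p - z j))) := by
  rw [Finset.sum_powerset_insert hp, ← Finset.sum_add_distrib]
  refine Finset.sum_congr rfl fun S hS => ?_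
  have hS := Finset.mem_powerset.1 hS
  rw [subsetTerm_insert_insert hp hS, subsetTerm_insert hp hS,
    Finset.card_insert_of_notMem fun h => hp (hS h)]
  ring

/-- The factors `∏ (z - t z_i) ∏ (z - z_j)` obtained by clearing denominators, as a polynomial
in `z`. -/
lemma prod_ite_left (hS : S ⊆ U) (y : ℂ) (hy : ∀ i ∈ U, y ≠ z i) :
    ∏ i ∈ U, (y - if i ∈ S then t * z i else z i) =
      (∏ i ∈ U, (y - z i)) * ∏ i ∈ S, (t * z i - y) / (z i - y) := by
  rw [← Finset.prod_sdiff hS, ← Finset.prod_sdiff hS, mul_assoc, ← Finset.prod_mul_distrib]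
  congr 1
  · exact Finset.prod_congr rfl fun i hi => by rw [if_neg (Finset.mem_sdiff.1 hi).2]
  · refine Finset.prod_congr rfl fun i hi => ?_
    have := sub_ne_zero.2 (hy i (hS hi)).symm
    rw [if_pos hi]; field_simp; ring

lemma prod_ite_right (hS : S ⊆ U) (y : ℂ) (hy : ∀ i ∈ U, y ≠ z i) :
    ∏ i ∈ U, ((if i ∈ S then 1 else t) * y - z i) =
      (∏ i ∈ U, (y - z i)) * ∏ j ∈ U \ S, (t * y - z j) / (y - z j) := by
  rw [← Finset.prod_sdiff hS, ← Finset.prod_sdiff hS, mul_right_comm, ← Finset.prod_mul_distrib]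
  congr 1
  · refine Finset.prod_congr rfl fun i hi => ?_
    have := sub_ne_zero.2 (hy i (Finset.mem_sdiff.1 hi).1)
    rw [if_neg (Finset.mem_sdiff.1 hi).2]; field_simp
  · exact Finset.prod_congr rfl fun i hi => by rw [if_pos hi, one_mul]

/-- The residues of a subset sum at coinciding variables cancel. -/
lemma sum_subsetTerm_residue (hz : Set.InjOn z U) (w : ℕ → ℂ) {m : ι} (hm : m ∈ U) :
    ∑ S ∈ U.powerset, subsetTerm t a c z U S *
      (w #S * ((1 - c * z m) * ∏ i ∈ U, (z m - if i ∈ S then t * z i else z i)) +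
        w (#S + 1) * ((1 - a * z m) * ∏ i ∈ U, ((if i ∈ S then 1 else t) * z m - z i))) = 0 := by
  obtain ⟨V, hmV, rfl⟩ : ∃ V, m ∉ V ∧ U = insert m V :=
    ⟨U.erase m, Finset.notMem_erase _ _, (Finset.insert_erase hm).symm⟩
  rw [Finset.sum_powerset_insert hmV, ← Finset.sum_add_distrib]
  refine Finset.sum_eq_zero fun S hS => ?_
  have hS := Finset.mem_powerset.1 hS
  have hmS : m ∉ S := fun h => hmV (hS h)
  have hy : ∀ i ∈ V, z m ≠ z i := fun i hi h =>
    hmV (hz (by simp) (by simp [hi]) h ▸ hi)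
  rw [subsetTerm_insert_insert hmV hS, subsetTerm_insert hmV hS,
    Finset.card_insert_of_notMem hmS]
  simp only [Finset.prod_insert hmV, if_neg hmS, Finset.mem_insert_self, if_true]
  have e1 : ∏ i ∈ V, (z m - if i ∈ insert m S then t * z i else z i) =
      (∏ i ∈ V, (z m - z i)) * ∏ i ∈ S, (t * z i - z m) / (z i - z m) := by
    rw [← prod_ite_left hS _ hy]
    refine Finset.prod_congr rfl fun i hi => ?_
    have : i ≠ m := fun h => hmV (h ▸ hi)
    simp [this]
  rw [e1, prod_ite_right hS _ hy]
  ring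

open Polynomial in
/-- A subset sum is a polynomial of degree at most one in each variable. -/
lemma sum_subsetTerm_insert_eq (hp : p ∉ U) (hz : Set.InjOn z (insert p U : Finset ι))
    (hz0 : ∀ i ∈ U, z i ≠ 0) (w : ℕ → ℂ) :
    ∑ S ∈ (insert p U).powerset, w #S * subsetTerm t a c z (insert p U) S =
      ∑ S ∈ U.powerset, ((w #S * t ^ #S + w (#S + 1)) -
        z p * (c * w #S + a * t ^ #(U \ S) * w (#S + 1))) * subsetTerm t a c z U S := by
  have hzU : Set.InjOn z U := hz.mono (by simp)
  have hy : ∀ i ∈ U, z p ≠ z i := fun i hi h => hp (hz (by simp) (by simp [hi]) h ▸ hi)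
  let A : Finset ι → ℂ[X] := fun S => ∏ i ∈ U, (X - C (if i ∈ S then t * z i else z i))
  let B : Finset ι → ℂ[X] := fun S => ∏ i ∈ U, (C (if i ∈ S then 1 else t) * X - C (z i))
  let T : ℂ[X] := ∏ i ∈ U, (X - C (z i))
  let P : ℂ[X] := ∑ S ∈ U.powerset, C (subsetTerm t a c z U S) *
    (C (w #S) * ((1 - C c * X) * A S) + C (w (#S + 1)) * ((1 - C a * X) * B S))
  let R : ℂ[X] := ∑ S ∈ U.powerset, C (subsetTerm t a c z U S) *
    ((C (w #S * t ^ #S + w (#S + 1)) -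
      X * C (c * w #S + a * t ^ #(U \ S) * w (#S + 1))) * T)
  have hTdeg : T.degree = (#U : ℕ) := by simp [T, degree_prod]
  have hu : ∀ S ∈ U.powerset, ∏ i ∈ U, (if i ∈ S then (1 : ℂ) else t) = t ^ #(U \ S) := by
    intro S hS
    have hS := Finset.mem_powerset.1 hS
    rw [← Finset.prod_sdiff hS, Finset.prod_congr rfl fun i hi =>
      if_neg (Finset.mem_sdiff.1 hi).2, Finset.prod_congr (rfl : S = S) fun i hi => if_pos hi]
    simp
  have hdeg : (P - R).degree < (#(insert 0 (U.image z)) : ℕ) := by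
    have hcard : #(insert 0 (U.image z)) = #U + 1 := by
      rw [Finset.card_insert_of_notMem, Finset.card_image_of_injOn hzU]
      simpa using hz0
    rw [hcard, ← Finset.sum_sub_distrib]
    refine (degree_sum_le _ _).trans_lt ((Finset.sup_lt_iff (WithBot.bot_lt_coe _)).2 ?_)
    intro S hS
    have hA := degree_prod_linear_sub_lt U (fun _ => 1) (fun i => if i ∈ S then t * z i else z i) z
    have hB := degree_prod_linear_sub_lt U (fun i => if i ∈ S then 1 else t) z z
    rw [hu S hS] at hB
    simp only [map_one, one_mul, Finset.prod_const_one] at hA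
    change (A S - T).degree < _ at hA
    change (B S - C (t ^ #(U \ S)) * T).degree < _ at hB
    have e : C (subsetTerm t a c z U S) *
        (C (w #S) * ((1 - C c * X) * A S) + C (w (#S + 1)) * ((1 - C a * X) * B S)) -
        C (subsetTerm t a c z U S) *
        ((C (w #S * t ^ #S + w (#S + 1)) -
          X * C (c * w #S + a * t ^ #(U \ S) * w (#S + 1))) * T) =
        C (subsetTerm t a c z U S) *
        (C (w #S) * (A S - T) + C (w #S * (1 - t ^ #S)) * T
          + C (w (#S + 1)) * (B S - C (t ^ #(U \ S)) * T)
          + C (w (#S + 1) * (t ^ #(U \ S) - 1)) * T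
          - (C (w #S * c) * (A S - T) + C (w (#S + 1) * a) * (B S - C (t ^ #(U \ S)) * T)) * X)
        := by
      simp only [C_mul, C_add, C_sub, C_1]
      ring
    have hn : ((#U : ℕ) : WithBot ℕ) < ((#U + 1 : ℕ) : WithBot ℕ) := by
      exact_mod_cast Nat.lt_succ_self _
    have hmem : ∀ f : ℂ[X], f.degree < (#U : ℕ) → f * X ∈ degreeLT ℂ (#U + 1) := by
      intro f hf
      refine mem_degreeLT.2 ?_
      rw [degree_mul, degree_X]
      rcases eq_or_ne f 0 with rfl | h0
      · simp
      · rw [degree_eq_natDegree h0] at hf ⊢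
        exact_mod_cast Nat.add_lt_add_right (by exact_mod_cast hf) 1
    have hCm : ∀ (r : ℂ) (f : ℂ[X]), f ∈ degreeLT ℂ (#U + 1) → C r * f ∈ degreeLT ℂ (#U + 1) := by
      intro r f hf
      rw [← smul_eq_C_mul]; exact Submodule.smul_mem _ _ hf
    have hA' : A S - T ∈ degreeLT ℂ (#U + 1) := mem_degreeLT.2 (hA.trans hn)
    have hB' : B S - C (t ^ #(U \ S)) * T ∈ degreeLT ℂ (#U + 1) := mem_degreeLT.2 (hB.trans hn)
    have hT' : T ∈ degreeLT ℂ (#U + 1) := mem_degreeLT.2 (hTdeg ▸ hn)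
    rw [e, ← mem_degreeLT]
    refine hCm _ _ (Submodule.sub_mem _ (Submodule.add_mem _ (Submodule.add_mem _
      (Submodule.add_mem _ (hCm _ _ hA') (hCm _ _ hT')) (hCm _ _ hB')) (hCm _ _ hT')) ?_)
    rw [add_mul, mul_assoc, mul_assoc]
    exact Submodule.add_mem _ (hCm _ _ (hmem _ hA)) (hCm _ _ (hmem _ hB))
  have hPR : P = R := by
    refine eq_of_degree_sub_lt_of_eval_finset_eq _ hdeg fun y hy => ?_
    rcases Finset.mem_insert.1 hy with rfl | hy
    · simp only [P, R, eval_finsetSum]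
      refine Finset.sum_congr rfl fun S hS => ?_
      have hS := Finset.mem_powerset.1 hS
      have hA0 : (A S).eval 0 = t ^ #S * T.eval 0 := by
        simp only [A, T, eval_prod]
        rw [← Finset.prod_sdiff hS, ← Finset.prod_sdiff hS, mul_left_comm,
          ← Finset.prod_const, ← Finset.prod_mul_distrib]
        congr 1
        · exact Finset.prod_congr rfl fun i hi => by simp [(Finset.mem_sdiff.1 hi).2]
        · exact Finset.prod_congr rfl fun i hi => by simp [hi]
      have hB0 : (B S).eval 0 = T.eval 0 := by simp [B, T, eval_prod]
      simp only [eval_mul, eval_add, eval_sub, eval_C, eval_X, eval_one, hA0, hB0]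
      ring
    · obtain ⟨m, hm, rfl⟩ := Finset.mem_image.1 hy
      have hT0 : T.eval (z m) = 0 := by
        simp only [T, eval_prod]
        exact Finset.prod_eq_zero hm (by simp)
      have hR : R.eval (z m) = 0 := by
        simp [R, eval_finsetSum, hT0]
      rw [hR, ← sum_subsetTerm_residue (t := t) (a := a) (c := c) hzU w hm]
      simp [P, A, B, eval_finsetSum, eval_prod]
  have hT : T.eval (z p) ≠ 0 := by
    simp only [T, eval_prod]
    exact Finset.prod_ne_zero_iff.2 fun i hi => by simpa using sub_ne_zero.2 (hy i hi)
  refine mul_right_cancel₀ hT ?_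
  have h := congrArg (eval (z p)) hPR
  rw [sum_subsetTerm_insert hp, Finset.sum_mul, Finset.sum_mul]
  simp only [P, R, eval_finsetSum] at h
  convert h using 1
  · refine Finset.sum_congr rfl fun S hS => ?_
    have hS := Finset.mem_powerset.1 hS
    have h1 := prod_ite_left (t := t) hS (z p) hy
    have h2 := prod_ite_right (t := t) hS (z p) hy
    simp only [A, B, T, eval_prod, eval_mul, eval_add, eval_sub, eval_C, eval_X, eval_one, h1, h2]
    ring
  · refine Finset.sum_congr rfl fun S hS => ?_
    simp only [eval_mul, eval_sub, eval_C, eval_X]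
    ring

end SubsetSum

lemma qPoch_succ (q a : ℂ) (k : ℕ) : qPoch q a (k + 1) = qPoch q a k * (1 - a * q ^ k) :=
  Finset.prod_range_succ _ _

lemma qPoch_succ' (q a : ℂ) (k : ℕ) : qPoch q a (k + 1) = (1 - a) * qPoch q (a * q) k := by
  simp only [qPoch, Finset.prod_range_succ', pow_zero, mul_one, pow_succ', mul_assoc]
  ring

lemma weight_recurrence {b c d y z e u B D : ℂ} (hb : b ≠ 0) (hy : y ≠ 0) (h0 : 1 - d ≠ 0)
    (h1 : 1 - d * y ≠ 0) (hD : D ≠ 0) :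
    e * u * (B / D) * y⁻¹ + e * -1 * (y⁻¹ * u) * (B * (1 - b * y) / (D * (1 - d * y))) -
        z * (c * (e * u * (B / D)) +
          d * c / b * y * (e * -1 * (y⁻¹ * u) * (B * (1 - b * y) / (D * (1 - d * y))))) =
      (b - d) / (1 - d) * (1 - c * z / b) * (e * u * (B / (D * (1 - d * y) / (1 - d)))) := by
  rw [mul_comm d y] at h1 ⊢
  field_simp
  ring

/-- The case `N = (1, …, 1)` of the `A_n` q-Pfaff–Saalschütz summation. -/
lemma sum_subsetTerm_saalschutz {ι : Type*} [DecidableEq ι] {q a b c : ℂ} (hq : q ≠ 0)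
    (hb : b ≠ 0) (hc : c ≠ 0) {z : ι → ℂ} (U : Finset ι)
    (hz : Set.InjOn z U) (hz0 : ∀ i ∈ U, z i ≠ 0)
    (hd : ∀ m < #U, 1 - a * b / c * q⁻¹ ^ m ≠ 0) :
    ∑ S ∈ U.powerset, ((-1) ^ #S * q⁻¹ ^ (#S).choose 2 *
        (qPoch q b #S / qPoch q (a * b / c * q * q⁻¹ ^ #U) #S)) *
        subsetTerm q⁻¹ a c z U S =
      (∏ m ∈ range #U, (b - a * b / c * q⁻¹ ^ m) / (1 - a * b / c * q⁻¹ ^ m)) *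
        ∏ i ∈ U, (1 - c * z i / b) := by
  induction U using Finset.induction_on with
  | empty => simp [subsetTerm, qPoch]
  | insert p U hp ih =>
    have ih := ih (hz.mono (by simp)) (fun i hi => hz0 i (by simp [hi]))
      fun m hm => hd m (hm.trans (by simp [hp]))
    rw [sum_subsetTerm_insert_eq hp hz (fun i hi => hz0 i (by simp [hi]))
      fun s => (-1) ^ s * q⁻¹ ^ s.choose 2 *
        (qPoch q b s / qPoch q (a * b / c * q * q⁻¹ ^ #(insert p U)) s)]
    rw [Finset.card_insert_of_notMem hp] at hd ⊢
    rw [Finset.prod_range_succ, Finset.prod_insert hp]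
    trans (b - a * b / c * q⁻¹ ^ #U) / (1 - a * b / c * q⁻¹ ^ #U) * (1 - c * z p / b) *
      ((∏ m ∈ range #U, (b - a * b / c * q⁻¹ ^ m) / (1 - a * b / c * q⁻¹ ^ m)) *
        ∏ i ∈ U, (1 - c * z i / b))
    · rw [← ih, Finset.mul_sum]
      refine Finset.sum_congr rfl fun S hS => ?_
      rw [← mul_assoc ((b - a * b / c * q⁻¹ ^ #U) / _ * _)]
      congr 1
      have hS := Finset.mem_powerset.1 hS
      obtain ⟨r, hr⟩ := Nat.exists_eq_add_of_le (Finset.card_le_card hS)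
      have hUS : #(U \ S) = r := by rw [Finset.card_sdiff_of_subset hS]; omega
      have hD : a * b / c * q * q⁻¹ ^ (#U + 1) = a * b / c * q⁻¹ ^ #U := by
        rw [pow_succ]
        linear_combination (a * b / c * q⁻¹ ^ #U) * mul_inv_cancel₀ hq
      have hpow : ∀ s, q⁻¹ ^ s * q ^ s = 1 := fun s => by
        rw [← mul_pow, inv_mul_cancel₀ hq, one_pow]
      have hD' : a * b / c * q * q⁻¹ ^ #U = a * b / c * q⁻¹ ^ #U * q := by ring
      have hne : ∀ s ≤ #U, 1 - a * b / c * q⁻¹ ^ #U * q ^ s ≠ 0 := by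
        intro s hs
        obtain ⟨k, hk⟩ := Nat.exists_eq_add_of_le hs
        have := hd k (by omega)
        rw [hk, pow_add]
        convert this using 2
        linear_combination (a * b / c * q⁻¹ ^ k) * hpow s
      have h1 := hne #S (by omega)
      have h0 := hne 0 (by omega)
      have hp0 : qPoch q (a * b / c * q⁻¹ ^ #U) #S ≠ 0 :=
        Finset.prod_ne_zero_iff.2 fun i hi => hne i (by have := Finset.mem_range.1 hi; omega)
      have hsucc := qPoch_succ q (a * b / c * q⁻¹ ^ #U) #S
      have hsucc' := qPoch_succ' q (a * b / c * q⁻¹ ^ #U) #S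
      rw [pow_zero, mul_one] at h0
      have hq1 : qPoch q (a * b / c * q⁻¹ ^ #U * q) #S =
          qPoch q (a * b / c * q⁻¹ ^ #U) #S * (1 - a * b / c * q⁻¹ ^ #U * q ^ #S) /
            (1 - a * b / c * q⁻¹ ^ #U) := by
        rw [eq_div_iff h0, ← hsucc, hsucc']; ring
      have hch : q⁻¹ ^ (#S + 1).choose 2 = q⁻¹ ^ #S * q⁻¹ ^ (#S).choose 2 := by
        rw [← pow_add, Nat.choose_succ_succ' #S 1, Nat.choose_one_right]
      rw [hUS, hD, hD', hq1, hsucc, qPoch_succ q b, hch, pow_succ (-1 : ℂ)]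
      have hr' : q⁻¹ ^ r = q⁻¹ ^ #U * q ^ #S := by
        rw [hr, pow_add]; linear_combination (-q⁻¹ ^ r) * hpow (#S)
      rw [hr']
      have hav : a * (q⁻¹ ^ #U * q ^ #S) = a * b / c * q⁻¹ ^ #U * c / b * q ^ #S := by
        field_simp
      rw [hav, inv_pow q #S]
      exact weight_recurrence hb (pow_ne_zero _ hq) h0 h1 hp0
    · ring

/-- A product over ordered pairs, split into its diagonal and the unordered pairs. -/
@[to_additive]
lemma prod_prod_eq_diag_mul_lt {ι M : Type*} [Fintype ι] [LinearOrder ι] [CommMonoid M]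
    (h : ι → ι → M) :
    ∏ i, ∏ j, h i j = (∏ i, h i i) * ∏ i, ∏ j, if i < j then h i j * h j i else 1 := by
  have h1 : ∏ i, ∏ j, (if j < i then h i j else 1) = ∏ i, ∏ j, if i < j then h j i else 1 :=
    Finset.prod_comm
  have h2 : ∏ i, h i i = ∏ i, ∏ j, if i = j then h i j else 1 := by simp
  have h3 : (∏ i, ∏ j, if i < j then h i j * h j i else 1) =
      (∏ i, ∏ j, if i < j then h i j else 1) * ∏ i, ∏ j, if j < i then h i j else 1 := by
    rw [h1]
    simp only [← Finset.prod_mul_distrib]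
    refine Finset.prod_congr rfl fun i _ => Finset.prod_congr rfl fun j _ => ?_
    split_ifs <;> simp
  rw [h2, h3]
  simp only [← Finset.prod_mul_distrib]
  refine Finset.prod_congr rfl fun i _ => Finset.prod_congr rfl fun j _ => ?_
  rcases lt_trichotomy i j with hij | rfl | hij
  · simp [hij, hij.ne, hij.not_gt]
  · simp
  · simp [hij, hij.ne', hij.not_gt]

lemma choose_sum_succ_two {ι : Type*} [Fintype ι] [LinearOrder ι] (k : ι → ℕ) :
    (∑ i, k i + 1).choose 2 =
      ∑ i, (k i + 1).choose 2 + ∑ i, ∑ j, if i < j then k i * k j else 0 := by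
  have h : ∀ m : ℕ, (m + 1).choose 2 * 2 = m * m + m := fun m => by
    induction m with
    | zero => rfl
    | succ m ih =>
      rw [Nat.choose_succ_succ' (m + 1) 1, Nat.choose_one_right, add_mul, ih]
      ring
  have h2 := sum_sum_eq_diag_add_lt fun i j => k i * k j
  rw [← Finset.sum_mul_sum] at h2
  refine Nat.eq_of_mul_eq_mul_right two_pos ?_
  rw [h, h2, add_mul, Finset.sum_mul, Finset.sum_congr rfl fun i _ => h (k i),
    Finset.sum_add_distrib, Finset.sum_mul]
  have h3 : ∑ i, ∑ j, (if i < j then k i * k j + k j * k i else 0) =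
      ∑ i, (∑ j, if i < j then k i * k j else 0) * 2 := by
    refine Finset.sum_congr rfl fun i _ => ?_
    rw [Finset.sum_mul]
    refine Finset.sum_congr rfl fun j _ => ?_
    split_ifs <;> ring
  rw [h3]
  ring

lemma prod_sub_mul_prod_sub (q x y : ℂ) (k l : ℕ) :
    (∏ s ∈ range (k + 1), (x * q ^ s - y * q ^ l)) * ∏ s ∈ range l, (x * q ^ k - y * q ^ s) =
      q ^ (k * l) * (∏ s ∈ range (k + 1), (x * q ^ s - y)) *
        ∏ s ∈ range l, (x - y * q ^ (s + 1)) := by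
  induction l with
  | zero => simp
  | succ l ih =>
    have h : (∏ s ∈ range (k + 1), (x * q ^ s - y * q ^ (l + 1))) * (x * q ^ k - y * q ^ l) =
        q ^ k * (x - y * q ^ (l + 1)) * ∏ s ∈ range (k + 1), (x * q ^ s - y * q ^ l) := by
      have h' : ∏ s ∈ range k, (x * q ^ (s + 1) - y * q ^ (l + 1)) =
          q ^ k * ∏ s ∈ range k, (x * q ^ s - y * q ^ l) := by
        rw [← Finset.card_range k, ← Finset.prod_const, Finset.card_range,
          ← Finset.prod_mul_distrib]
        exact Finset.prod_congr rfl fun s _ => by ring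
      rw [Finset.prod_range_succ', h', Finset.prod_range_succ]
      ring
    rw [Finset.prod_range_succ _ l, Finset.prod_range_succ _ l, mul_add_one, pow_add q (k * l) k]
    generalize ∏ s ∈ range (k + 1), (x * q ^ s - y * q ^ (l + 1)) = P at *
    linear_combination (∏ s ∈ range l, (x * q ^ k - y * q ^ s)) * h +
      q ^ k * (x - y * q ^ (l + 1)) * ih

/-- The product of the differences `1 - (x q^s) / (y q^l)` for `s < k`. -/
noncomputable def diffProd (q x y : ℂ) (k l : ℕ) : ℂ := ∏ s ∈ range k, (1 - x / y * q ^ s / q ^ l)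

lemma diffProd_mul_diffProd {q x y : ℂ} (hq : q ≠ 0) (hx : x ≠ 0) (hy : y ≠ 0) (hxy : x ≠ y)
    (k l : ℕ) :
    (x * q ^ k - y * q ^ l) / (x - y) * (diffProd q x y k l * diffProd q y x l k) * q ^ (k * l) =
      qPoch q (q * x / y) k * qPoch q (q * y / x) l := by
  have hxy := sub_ne_zero.2 hxy
  have e1 : diffProd q x y k l =
      (∏ s ∈ range k, (x * q ^ s - y * q ^ l)) / (-y * q ^ l) ^ k := by
    rw [diffProd, ← Finset.card_range k, ← Finset.prod_const, Finset.card_range,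
      ← Finset.prod_div_distrib]
    refine Finset.prod_congr rfl fun s _ => ?_
    field_simp
    ring
  have e2 : diffProd q y x l k =
      (∏ s ∈ range l, (x * q ^ k - y * q ^ s)) / (x * q ^ k) ^ l := by
    rw [diffProd, ← Finset.card_range l, ← Finset.prod_const, Finset.card_range,
      ← Finset.prod_div_distrib]
    refine Finset.prod_congr rfl fun s _ => ?_
    field_simp
  have e3 : qPoch q (q * x / y) k =
      (∏ s ∈ range k, (x * q ^ (s + 1) - y)) / (-y) ^ k := by
    rw [qPoch, ← Finset.card_range k, ← Finset.prod_const, Finset.card_range,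
      ← Finset.prod_div_distrib]
    refine Finset.prod_congr rfl fun s _ => ?_
    field_simp
    ring
  have e4 : qPoch q (q * y / x) l =
      (∏ s ∈ range l, (x - y * q ^ (s + 1))) / x ^ l := by
    rw [qPoch, ← Finset.card_range l, ← Finset.prod_const, Finset.card_range,
      ← Finset.prod_div_distrib]
    refine Finset.prod_congr rfl fun s _ => ?_
    field_simp
    ring
  have h := prod_sub_mul_prod_sub q x y k l
  rw [Finset.prod_range_succ, Finset.prod_range_succ' _ k] at h
  rw [e1, e2, e3, e4, mul_pow, mul_pow, ← pow_mul, ← pow_mul, mul_comm l k]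
  rw [pow_zero, mul_one] at h
  have hn : (-y) ^ k ≠ 0 := pow_ne_zero _ (neg_ne_zero.2 hy)
  have hn2 : q ^ (k * l) ≠ 0 := pow_ne_zero _ hq
  generalize q ^ (k * l) = Q at *
  generalize (-y) ^ k = Y at *
  field_simp
  linear_combination h

lemma diffProd_self {q x : ℂ} (hq : q ≠ 0) (hx : x ≠ 0) (k : ℕ) :
    diffProd q x x k k * q ^ (k + 1).choose 2 = (-1) ^ k * qPoch q (q * x / x) k := by
  have h : diffProd q x x k k = ∏ s ∈ range k, (1 - 1 / q ^ (s + 1)) := by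
    rw [diffProd, ← Finset.prod_range_reflect]
    refine Finset.prod_congr rfl fun s hs => ?_
    obtain ⟨r, rfl⟩ := Nat.exists_eq_add_of_lt (Finset.mem_range.1 hs)
    rw [show s + r + 1 - 1 - s = r by omega, show s + r + 1 = r + (s + 1) by ring, pow_add]
    field_simp
  rw [h, mul_div_assoc, div_self hx, mul_one]
  clear h
  induction k with
  | zero => simp [qPoch]
  | succ k ih =>
    have hk : (k + 1 + 1).choose 2 = (k + 1) + (k + 1).choose 2 := by
      rw [Nat.choose_succ_succ' (k + 1) 1, Nat.choose_one_right]
    rw [Finset.prod_range_succ, hk, pow_add, qPoch_succ, pow_succ]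
    have e : (1 - 1 / q ^ (k + 1)) * q ^ (k + 1) = -1 * (1 - q * q ^ k) := by
      field_simp
      ring
    linear_combination (-1) ^ k * qPoch q q k * e + (1 - 1 / q ^ (k + 1)) * q ^ (k + 1) * ih

/-- The Vandermonde ratio of an `A_n` series in terms of q-shifted factorials. -/
lemma vandermonde_mul_prod_diffProd {ι : Type*} [Fintype ι] [LinearOrder ι] {q : ℂ} (hq : q ≠ 0)
    {x : ι → ℂ} (hx : ∀ i, x i ≠ 0) (hxd : ∀ i j, i ≠ j → x i ≠ x j) (k : ι → ℕ) :
    (∏ i, ∏ j, if i < j then (x i * q ^ k i - x j * q ^ k j) / (x i - x j) else 1) *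
        (∏ i, ∏ j, diffProd q (x i) (x j) (k i) (k j)) * q ^ (∑ i, k i + 1).choose 2 =
      (-1) ^ (∑ i, k i) * ∏ i, ∏ j, qPoch q (q * x i / x j) (k i) := by
  have hpow : q ^ (∑ i, k i + 1).choose 2 = (∏ i, q ^ (k i + 1).choose 2) *
      ∏ i, ∏ j, if i < j then q ^ (k i * k j) else 1 := by
    rw [choose_sum_succ_two, pow_add, ← Finset.prod_pow_eq_pow_sum, ← Finset.prod_pow_eq_pow_sum]
    congr 1
    refine Finset.prod_congr rfl fun i _ => ?_
    rw [← Finset.prod_pow_eq_pow_sum]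
    refine Finset.prod_congr rfl fun j _ => ?_
    split_ifs <;> simp
  have hdiag : (∏ i, diffProd q (x i) (x i) (k i) (k i)) * ∏ i, q ^ (k i + 1).choose 2 =
      (-1) ^ (∑ i, k i) * ∏ i, qPoch q (q * x i / x i) (k i) := by
    rw [← Finset.prod_pow_eq_pow_sum, ← Finset.prod_mul_distrib, ← Finset.prod_mul_distrib]
    exact Finset.prod_congr rfl fun i _ => diffProd_self hq (hx i) (k i)
  have hoff : (∏ i, ∏ j, if i < j then (x i * q ^ k i - x j * q ^ k j) / (x i - x j) else 1) *
        (∏ i, ∏ j, if i < j then diffProd q (x i) (x j) (k i) (k j) *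
          diffProd q (x j) (x i) (k j) (k i) else 1) *
        (∏ i, ∏ j, if i < j then q ^ (k i * k j) else 1) =
      ∏ i, ∏ j, if i < j then qPoch q (q * x i / x j) (k i) * qPoch q (q * x j / x i) (k j)
        else 1 := by
    simp only [← Finset.prod_mul_distrib]
    refine Finset.prod_congr rfl fun i _ => Finset.prod_congr rfl fun j _ => ?_
    split_ifs with hij
    · exact diffProd_mul_diffProd hq (hx i) (hx j) (hxd i j hij.ne) _ _
    · simp
  rw [hpow, prod_prod_eq_diag_mul_lt fun i j => diffProd q (x i) (x j) (k i) (k j),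
    prod_prod_eq_diag_mul_lt fun i j => qPoch q (q * x i / x j) (k i), ← hoff]
  linear_combination
    (∏ i, ∏ j, if i < j then (x i * q ^ k i - x j * q ^ k j) / (x i - x j) else 1) *
        (∏ i, ∏ j, if i < j then diffProd q (x i) (x j) (k i) (k j) *
          diffProd q (x j) (x i) (k j) (k i) else 1) *
        (∏ i, ∏ j, if i < j then q ^ (k i * k j) else 1) * hdiag

lemma prod_Ico_div_telescope {q X y : ℂ} (hq : q ≠ 0) {k N : ℕ} (hkN : k ≤ N)
    (h : ∀ t, k ≤ t → t ≤ N → X ≠ y * q ^ t) :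
    ∏ t ∈ Ico k N, (q⁻¹ * X - y * q ^ t) / (X - y * q ^ t) =
      q ^ k * (X - y * q ^ N) / (q ^ N * (X - y * q ^ k)) := by
  induction N, hkN using Nat.le_induction with
  | base =>
    have := sub_ne_zero.2 (h k le_rfl le_rfl)
    rw [Finset.Ico_self, Finset.prod_empty, div_self (by positivity)]
  | succ N hkN ih =>
    have h1 := sub_ne_zero.2 (h k le_rfl (by omega))
    have h2 := sub_ne_zero.2 (h N hkN (by omega))
    rw [Finset.prod_Ico_succ_top hkN, ih fun t h1 h2 => h t h1 (by omega)]
    field_simp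
    ring

lemma subsetTerm_sigma_range {ι : Type*} [Fintype ι] [DecidableEq ι] {q a c : ℂ} (hq : q ≠ 0)
    {x : ι → ℂ} (hx : ∀ i, x i ≠ 0) {N k : ι → ℕ} (hk : ∀ i, k i ≤ N i)
    (hne : ∀ i j s t, s < k i → k j ≤ t → t ≤ N j → x i * q ^ s ≠ x j * q ^ t) :
    subsetTerm q⁻¹ a c (fun p : (_ : ι) × ℕ => x p.1 * q ^ p.2)
        (univ.sigma fun i => range (N i)) (univ.sigma fun i => range (k i)) =
      (∏ i, ∏ j, qPoch q (q ^ (-(N j : ℤ)) * x i / x j) (k i) /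
          diffProd q (x i) (x j) (k i) (k j)) *
        (∏ i, qPoch q (a * x i) (k i)) *
        ∏ i, ∏ t ∈ Ico (k i) (N i), (1 - c * x i * q ^ t) := by
  have hsd : (univ.sigma fun i => range (N i)) \ (univ.sigma fun i => range (k i)) =
      univ.sigma fun i => Ico (k i) (N i) := by
    ext ⟨i, s⟩
    simp [and_comm]
  rw [subsetTerm, hsd]
  simp only [Finset.prod_sigma, qPoch, mul_assoc]
  congr 1
  refine Finset.prod_congr rfl fun i _ => ?_
  rw [Finset.prod_comm]
  refine Finset.prod_congr rfl fun j _ => ?_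
  rw [diffProd, ← Finset.prod_div_distrib]
  refine Finset.prod_congr rfl fun s hs => ?_
  have hs := Finset.mem_range.1 hs
  rw [prod_Ico_div_telescope hq (hk j) fun t h1 h2 => hne i j s t hs h1 h2]
  have h1 := sub_ne_zero.2 (hne i j s (k j) hs le_rfl (hk j))
  have h2 := hx j
  have h3 : 1 - x i / x j * q ^ s / q ^ k j ≠ 0 := by
    intro h
    apply h1
    field_simp at h
    linear_combination -h
  rw [zpow_neg, zpow_natCast, div_eq_div_iff (by positivity) h3]
  field_simp
  ring

/-- Only the subsets that are initial segments in each block contribute. -/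
lemma exists_eq_sigma_range_of_subsetTerm_ne_zero {ι : Type*} [Fintype ι] [DecidableEq ι]
    {q a c : ℂ} (hq : q ≠ 0) {x : ι → ℂ} {N : ι → ℕ} {S : Finset ((_ : ι) × ℕ)}
    (hS : S ⊆ univ.sigma fun i => range (N i))
    (h : subsetTerm q⁻¹ a c (fun p : (_ : ι) × ℕ => x p.1 * q ^ p.2)
      (univ.sigma fun i => range (N i)) S ≠ 0) :
    ∃ k : ι → ℕ, (∀ i, k i ≤ N i) ∧ (univ.sigma fun i => range (k i)) = S := by
  have hstep : ∀ i s, (⟨i, s + 1⟩ : (_ : ι) × ℕ) ∈ S → (⟨i, s⟩ : (_ : ι) × ℕ) ∈ S := by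
    intro i s hs
    by_contra hs'
    refine h ?_
    have hsN : s + 1 < N i := by simpa using hS hs
    rw [subsetTerm, mul_assoc]
    refine mul_eq_zero_of_left (Finset.prod_eq_zero hs (Finset.prod_eq_zero (i := ⟨i, s⟩) ?_ ?_)) _
    · simpa [hs'] using by omega
    · rw [pow_succ]
      field_simp
      simp
  have hdown : ∀ i d s, (⟨i, s + d⟩ : (_ : ι) × ℕ) ∈ S → (⟨i, s⟩ : (_ : ι) × ℕ) ∈ S := by
    intro i d
    induction d with
    | zero => exact fun s hs => hs
    | succ d ih => exact fun s hs => ih s (hstep i _ hs)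
  refine ⟨fun i => ((range (N i)).filter fun s => (⟨i, s⟩ : (_ : ι) × ℕ) ∈ S).sup (· + 1),
    fun i => Finset.sup_le fun s hs => ?_, ?_⟩
  · have := Finset.mem_range.1 (Finset.mem_filter.1 hs).1
    omega
  · ext ⟨i, s⟩
    simp only [Finset.mem_sigma, Finset.mem_univ, true_and, Finset.mem_range, Finset.lt_sup_iff,
      Finset.mem_filter]
    constructor
    · rintro ⟨r, ⟨-, hr⟩, hsr⟩
      obtain ⟨d, rfl⟩ := Nat.exists_eq_add_of_le (Nat.lt_succ_iff.1 hsr)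
      exact hdown i d s hr
    · exact fun hs => ⟨s, ⟨by simpa using hS hs, hs⟩, Nat.lt_succ_self s⟩

/-- `A_n` q-Pfaff–Saalschütz summation (first form). -/
theorem stmt_12 (n : ℕ) (hn : 0 < n) (N : Fin n → ℕ) (q : ℂ) (hq : q ≠ 0)
    (hqru : ∀ m : ℕ, 0 < m → q ^ m ≠ 1)
    (a b c : ℂ) (x : Fin n → ℂ) (ha : a ≠ 0) (hb : b ≠ 0) (hc : c ≠ 0)
    (hx : ∀ i, x i ≠ 0) (hxd : ∀ i j : Fin n, i ≠ j → x i ≠ x j)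
    (hd1 : ∀ i j : Fin n, ∀ m ≤ N i, qPoch q (q * x i / x j) m ≠ 0)
    (hd2 : ∀ i : Fin n, ∀ m ≤ N i, qPoch q (c * x i) m ≠ 0)
    (hd3 : ∀ m ≤ ∑ j, N j,
      qPoch q (a * b * q ^ (1 - (∑ j, N j : ℤ)) / c) m ≠ 0)
    (hd4 : qPoch q (c / (a * b)) (∑ j, N j) ≠ 0) :
    ∑ k ∈ Fintype.piFinset (fun i => Finset.range (N i + 1)),
      ((∏ i, ∏ j, if i < j then (x i * q ^ k i - x j * q ^ k j) / (x i - x j) else 1) *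
        (∏ i, ∏ j, qPoch q (q ^ (-(N j : ℤ)) * x i / x j) (k i) /
          qPoch q (q * x i / x j) (k i)) *
        (∏ i, qPoch q (a * x i) (k i) / qPoch q (c * x i) (k i)) *
        (qPoch q b (∑ i, k i) /
          qPoch q (a * b * q ^ (1 - (∑ j, N j : ℤ)) / c) (∑ i, k i)) *
        q ^ (∑ i, k i)) =
      qPoch q (c / a) (∑ i, N i) / qPoch q (c / (a * b)) (∑ i, N i) *
        ∏ i, qPoch q (c * x i / b) (N i) / qPoch q (c * x i) (N i) := by
  have hdist : ∀ i j m, 1 ≤ m → m ≤ N i → x i * q ^ m ≠ x j := by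
    intro i j m h1 hm h
    refine Finset.prod_ne_zero_iff.1 (hd1 i j m hm) (m - 1) (by simp; omega) ?_
    have h2 : q * q ^ (m - 1) = q ^ m := by rw [← pow_succ', Nat.sub_add_cancel h1]
    rw [sub_eq_zero, div_mul_eq_mul_div, eq_comm, div_eq_one_iff_eq (hx j), ← h, ← h2]
    ring
  have hle : ∀ i j s t, s ≤ N i → t ≤ s → x i * q ^ s = x j * q ^ t → i = j ∧ s = t := by
    intro i j s t hs hts h
    obtain ⟨d, rfl⟩ := Nat.exists_eq_add_of_le hts
    have h' : x i * q ^ d = x j := by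
      refine mul_right_cancel₀ (pow_ne_zero t hq) ?_
      rw [← h, pow_add]; ring
    have hd : d = 0 := by
      by_contra hd
      exact hdist i j d (by omega) (by omega) h'
    subst hd
    refine ⟨?_, rfl⟩
    by_contra hij
    exact hxd i j hij (by simpa using h')
  have hinj : ∀ i j s t, s ≤ N i → t ≤ N j → x i * q ^ s = x j * q ^ t → i = j ∧ s = t := by
    intro i j s t hs ht h
    rcases le_total t s with hts | hts
    · exact hle i j s t hs hts h
    · exact (hle j i t s ht hts h.symm).imp Eq.symm Eq.symm
  have hcard : #(univ.sigma fun i => range (N i)) = ∑ i, N i := by simp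
  have hfac : ∀ m, 1 - a * b / c * q⁻¹ ^ m = -(a * b / c * q⁻¹ ^ m) * (1 - c / (a * b) * q ^ m) := by
    intro m
    rw [inv_pow]
    field_simp
    ring
  have hfac' : ∀ m, b - a * b / c * q⁻¹ ^ m = -(a * b / c * q⁻¹ ^ m) * (1 - c / a * q ^ m) := by
    intro m
    rw [inv_pow]
    field_simp
    ring
  have hcoef : ∀ m, -(a * b / c * q⁻¹ ^ m) ≠ 0 := fun m =>
    neg_ne_zero.2 (mul_ne_zero (div_ne_zero (mul_ne_zero ha hb) hc)
      (pow_ne_zero _ (inv_ne_zero hq)))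
  have key := sum_subsetTerm_saalschutz (a := a) hq hb hc
    (z := fun p : (_ : Fin n) × ℕ => x p.1 * q ^ p.2) (univ.sigma fun i => range (N i))
    (by
      rintro ⟨i, s⟩ hs ⟨j, t⟩ ht h
      simp only [Finset.coe_sigma, Set.mem_sigma_iff, Finset.coe_range, Set.mem_Iio] at hs ht
      obtain ⟨rfl, rfl⟩ := hinj i j s t hs.2.le ht.2.le h
      rfl)
    (fun p _ => mul_ne_zero (hx _) (pow_ne_zero _ hq))
    (by
      intro m hm
      rw [hcard] at hm
      rw [hfac]
      exact mul_ne_zero (hcoef m) (Finset.prod_ne_zero_iff.1 hd4 m (Finset.mem_range.2 hm)))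
  have hDen : a * b * q ^ (1 - (∑ j, N j : ℤ)) / c = a * b / c * q * q⁻¹ ^ (∑ j, N j) := by
    rw [zpow_sub₀ hq, zpow_one, ← Nat.cast_sum, zpow_natCast, inv_pow]
    ring
  have hcN : ∏ i, qPoch q (c * x i) (N i) ≠ 0 :=
    Finset.prod_ne_zero_iff.2 fun i _ => hd2 i _ le_rfl
  rw [hcard] at key
  have hR : (∏ m ∈ range (∑ i, N i), (b - a * b / c * q⁻¹ ^ m) / (1 - a * b / c * q⁻¹ ^ m)) =
      qPoch q (c / a) (∑ i, N i) / qPoch q (c / (a * b)) (∑ i, N i) := by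
    rw [qPoch, qPoch, ← Finset.prod_div_distrib]
    refine Finset.prod_congr rfl fun m _ => ?_
    rw [hfac, hfac', mul_div_mul_left _ _ (hcoef m)]
  have hR' : ∏ p ∈ univ.sigma (fun i => range (N i)), (1 - c * (x p.1 * q ^ p.2) / b) =
      ∏ i, qPoch q (c * x i / b) (N i) := by
    rw [Finset.prod_sigma]
    refine Finset.prod_congr rfl fun i _ => Finset.prod_congr rfl fun s _ => ?_
    ring
  rw [hR, hR'] at key
  rw [Finset.prod_div_distrib, ← mul_div_assoc, ← key, Finset.sum_div]
  refine Finset.sum_of_injOn (fun k => univ.sigma fun i => range (k i)) ?_ ?_ ?_ ?_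
  · intro k _ k' _ h
    ext i
    have h' : ∀ s, s < k i ↔ s < k' i := fun s => by
      have := Finset.ext_iff.1 h ⟨i, s⟩
      simpa using this
    exact le_antisymm (le_of_forall_lt fun s hs => (h' s).1 hs)
      (le_of_forall_lt fun s hs => (h' s).2 hs)
  · intro k hk
    have hk : ∀ i, k i < N i + 1 := by simpa using hk
    simp only [Finset.coe_powerset, Set.mem_preimage, Set.mem_powerset_iff, Finset.coe_subset]
    exact Finset.sigma_mono subset_rfl fun i =>
      Finset.range_subset_range.2 (Nat.lt_succ_iff.1 (hk i))
  · intro S hS hS'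
    rw [div_eq_zero_iff, mul_eq_zero]
    refine Or.inl (Or.inr ?_)
    by_contra h
    obtain ⟨k, hk, rfl⟩ :=
      exists_eq_sigma_range_of_subsetTerm_ne_zero hq (Finset.mem_powerset.1 hS) h
    exact hS' ⟨k, by simpa [Nat.lt_succ_iff] using hk, rfl⟩
  · intro k hk
    have hk : ∀ i, k i ≤ N i := fun i => by
      have := Fintype.mem_piFinset.1 hk i
      rw [Finset.mem_range] at this
      omega
    have hne : ∀ i j s t, s < k i → k j ≤ t → t ≤ N j → x i * q ^ s ≠ x j * q ^ t := by
      intro i j s t hs hkt htN h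
      obtain ⟨rfl, rfl⟩ := hinj i j s t (hs.le.trans (hk i)) htN h
      omega
    have hcardk : #(univ.sigma fun i => range (k i)) = ∑ i, k i := by simp
    have hV := vandermonde_mul_prod_diffProd hq hx hxd k
    have hE : ∏ i, ∏ j, diffProd q (x i) (x j) (k i) (k j) ≠ 0 := by
      refine Finset.prod_ne_zero_iff.2 fun i _ => Finset.prod_ne_zero_iff.2 fun j _ =>
        Finset.prod_ne_zero_iff.2 fun s hs h => ?_
      refine hne i j s (k j) (Finset.mem_range.1 hs) le_rfl (hk j) ?_
      have := hx j
      field_simp at h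
      linear_combination -h
    have hG : ∏ i, ∏ j, qPoch q (q * x i / x j) (k i) ≠ 0 :=
      Finset.prod_ne_zero_iff.2 fun i _ => Finset.prod_ne_zero_iff.2 fun j _ => hd1 i j _ (hk i)
    have hch : q ^ (∑ i, k i + 1).choose 2 = q ^ (∑ i, k i) * q ^ (∑ i, k i).choose 2 := by
      rw [← pow_add, Nat.choose_succ_succ' _ 1, Nat.choose_one_right]
    have hck : ∏ i, qPoch q (c * x i) (N i) = (∏ i, qPoch q (c * x i) (k i)) *
        ∏ i, ∏ t ∈ Ico (k i) (N i), (1 - c * x i * q ^ t) := by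
      rw [← Finset.prod_mul_distrib]
      exact Finset.prod_congr rfl fun i _ => (Finset.prod_range_mul_prod_Ico _ (hk i)).symm
    rw [hck] at hcN ⊢
    rw [hcardk, subsetTerm_sigma_range hq hx hk hne, hDen]
    rw [hch] at hV
    simp only [Finset.prod_div_distrib]
    rw [inv_pow q (Nat.choose _ 2)]
    have hc1 := left_ne_zero_of_mul hcN
    have hc2 := right_ne_zero_of_mul hcN
    have hq1 : q ^ (∑ i, k i).choose 2 ≠ 0 := pow_ne_zero _ hq
    rw [div_eq_mul_inv (qPoch q b _)]
    generalize (qPoch q (a * b / c * q * q⁻¹ ^ ∑ j, N j) (∑ i, k i))⁻¹ = B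
    generalize (∏ i, ∏ j, if i < j then (x i * q ^ k i - x j * q ^ k j) / (x i - x j) else 1) = V
      at *
    field_simp
    linear_combination
      (∏ i, ∏ j, qPoch q (q ^ (-(N j : ℤ)) * x i / x j) (k i)) * (∏ i, qPoch q (a * x i) (k i)) *
        qPoch q b (∑ i, k i) * B * hV
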